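/- Let K be a field of characteristic zero, m ≥ 1, V = K^{2m} with standard basis e_1, …, e_{2m}, and ω := Σ_{i=1}^m e_i ∧ e_{m+i} ∈ ⋀^2 V. For 0 ≤ j ≤ m, the space of primitive j-vectors P^j := {α ∈ ⋀^j V : ω^{m−j+1} ∧ α = 0} has dimension dim_K P^j = C(2m, j) − C(2m, j−2), where C(a,b) denotes the binomial coefficient and C(2m, −1) = C(2m, −2) = 0. -/

import Mathlib

open ExteriorAlgebra in
/-- The standard symplectic bivector `ω = ∑_{i=1}^m e_i ∧ e_{m+i}` in `⋀² K^{2m}`, viewed as an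
element of the exterior algebra of `K^{2m}`. -/
noncomputable def stdSymplecticBivector (K : Type*) [Field K] (m : ℕ) :
    ExteriorAlgebra K (Fin (2 * m) → K) :=
  ∑ i : Fin m,
    ι K (Pi.single (⟨(i : ℕ), by omega⟩ : Fin (2 * m)) (1 : K)) *
      ι K (Pi.single (⟨m + (i : ℕ), by omega⟩ : Fin (2 * m)) (1 : K))

/-- The space `P^j = {α ∈ ⋀^j K^{2m} : ω^{m-j+1} ∧ α = 0}` of primitive `j`-vectors, viewed as a
submodule of the exterior algebra of `K^{2m}`. -/
noncomputable def primitiveSubspace (K : Type*) [Field K] (m j : ℕ) :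
    Submodule K (ExteriorAlgebra K (Fin (2 * m) → K)) :=
  ⋀[K]^j (Fin (2 * m) → K) ⊓
    LinearMap.ker (LinearMap.mulLeft K ((stdSymplecticBivector K m) ^ (m - j + 1)))

/-- The standard symplectic matrix `J` on `K^{2m}`: the matrix of the nondegenerate alternating
bilinear form whose value on the basis pairs `(e_i, e_{m+i})` is `1`. -/
def stdSymplecticMatrix (K : Type*) [Field K] (m : ℕ) :
    Matrix (Fin (2 * m)) (Fin (2 * m)) K :=
  Matrix.of fun i j =>
    if (i : ℕ) + m = (j : ℕ) then 1 else if (j : ℕ) + m = (i : ℕ) then -1 else 0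

open ExteriorAlgebra

namespace PrimAux

variable {K : Type*} [Field K]

/-- contraction on the exterior algebra -/
noncomputable def ctr {m : ℕ} (t : Fin (2 * m)) :
    ExteriorAlgebra K (Fin (2 * m) → K) →ₗ[K] ExteriorAlgebra K (Fin (2 * m) → K) :=
  CliffordAlgebra.contractLeft (Q := (0 : QuadraticForm K (Fin (2 * m) → K)))
    (LinearMap.proj t : (Fin (2 * m) → K) →ₗ[K] K)

lemma ctr_mul {m : ℕ} (t : Fin (2 * m)) (a : Fin (2 * m) → K)
    (x : ExteriorAlgebra K (Fin (2 * m) → K)) :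
    ctr t (ι K a * x) = a t • x - ι K a * ctr t x :=
  CliffordAlgebra.contractLeft_ι_mul (Q := (0 : QuadraticForm K (Fin (2 * m) → K))) _ a x

lemma ctr_zero {m : ℕ} (t : Fin (2 * m)) (x : ExteriorAlgebra K (Fin (2 * m) → K))
    (hx : x ∈ ⋀[K]^0 (Fin (2 * m) → K)) : ctr t x = 0 := by
  rw [exteriorPower, pow_zero, Submodule.mem_one] at hx
  obtain ⟨r, rfl⟩ := hx
  exact CliffordAlgebra.contractLeft_algebraMap
    (Q := (0 : QuadraticForm K (Fin (2 * m) → K))) _ r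

lemma ext_ind {m k : ℕ} {P : ExteriorAlgebra K (Fin (2 * m) → K) → Prop}
    (h : ∀ a, ∀ b ∈ ⋀[K]^k (Fin (2 * m) → K), P (ι K a * b))
    (hadd : ∀ x y, P x → P y → P (x + y))
    (x : ExteriorAlgebra K (Fin (2 * m) → K)) (hx : x ∈ ⋀[K]^(k + 1) (Fin (2 * m) → K)) :
    P x := by
  rw [exteriorPower, pow_succ'] at hx
  refine Submodule.mul_induction_on hx ?_ hadd
  rintro _ ⟨a, rfl⟩ b hb
  exact h a b hb

lemma mul_mem_ext {m k l : ℕ} {x y : ExteriorAlgebra K (Fin (2 * m) → K)}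
    (hx : x ∈ ⋀[K]^k (Fin (2 * m) → K)) (hy : y ∈ ⋀[K]^l (Fin (2 * m) → K)) :
    x * y ∈ ⋀[K]^(k + l) (Fin (2 * m) → K) := by
  rw [exteriorPower, pow_add]
  exact Submodule.mul_mem_mul hx hy

lemma ι_mem_ext {m : ℕ} (a : Fin (2 * m) → K) : ι K a ∈ ⋀[K]^1 (Fin (2 * m) → K) := by
  rw [exteriorPower, pow_one]
  exact ⟨a, rfl⟩

lemma ctr_mem {m : ℕ} (t : Fin (2 * m)) : ∀ (k : ℕ) (x : ExteriorAlgebra K (Fin (2 * m) → K)),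
    x ∈ ⋀[K]^(k + 1) (Fin (2 * m) → K) → ctr t x ∈ ⋀[K]^k (Fin (2 * m) → K) := by
  intro k
  induction k with
  | zero =>
    refine ext_ind ?_ ?_
    · intro a b hb
      rw [ctr_mul, ctr_zero t b hb, mul_zero, sub_zero]
      exact Submodule.smul_mem _ _ hb
    · intro x y hx hy
      rw [map_add]; exact Submodule.add_mem _ hx hy
  | succ k ih =>
    refine ext_ind ?_ ?_
    · intro a b hb
      rw [ctr_mul]
      refine Submodule.sub_mem _ (Submodule.smul_mem _ _ hb) ?_
      rw [add_comm k 1]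
      exact mul_mem_ext (ι_mem_ext a) (ih b hb)
    · intro x y hx hy
      rw [map_add]; exact Submodule.add_mem _ hx hy

/-- first half index -/
def p {m : ℕ} (i : Fin m) : Fin (2 * m) := ⟨(i : ℕ), by omega⟩
/-- second half index -/
def q {m : ℕ} (i : Fin m) : Fin (2 * m) := ⟨m + (i : ℕ), by omega⟩

/-- basis vector in the algebra -/
noncomputable def e {m : ℕ} (t : Fin (2 * m)) : ExteriorAlgebra K (Fin (2 * m) → K) :=
  ι K (Pi.single t (1 : K))

lemma omega_eq (m : ℕ) : stdSymplecticBivector K m = ∑ i : Fin m, e (p i) * e (q i) := rfl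

lemma sum_pq {m : ℕ} {A : Type*} [AddCommMonoid A] (f : Fin (2 * m) → A) :
    ∑ t, f t = ∑ i : Fin m, (f (p i) + f (q i)) := by
  rw [← (finCongr (two_mul m).symm).sum_comp, Fin.sum_univ_add, Finset.sum_add_distrib]
  rfl

lemma ctr_e_mul {m : ℕ} (s t : Fin (2 * m)) (x : ExteriorAlgebra K (Fin (2 * m) → K)) :
    ctr s (e t * x) = (if s = t then x else 0) - e t * ctr s x := by
  rw [e, ctr_mul, Pi.single_apply]
  split_ifs <;> simp

/-- the dual Lefschetz operator -/
noncomputable def Lam (m : ℕ) :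
    ExteriorAlgebra K (Fin (2 * m) → K) →ₗ[K] ExteriorAlgebra K (Fin (2 * m) → K) :=
  ∑ i : Fin m, ctr (q i) ∘ₗ ctr (p i)

/-- the number operator -/
noncomputable def Num (m : ℕ) (x : ExteriorAlgebra K (Fin (2 * m) → K)) :
    ExteriorAlgebra K (Fin (2 * m) → K) := ∑ t, e t * ctr t x

lemma Num_eq {m : ℕ} : ∀ (k : ℕ) (x : ExteriorAlgebra K (Fin (2 * m) → K)),
    x ∈ ⋀[K]^k (Fin (2 * m) → K) → Num m x = (k : K) • x := by
  intro k
  induction k with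
  | zero =>
    intro x hx
    simp [Num, ctr_zero _ x hx]
  | succ k ih =>
    refine ext_ind ?_ ?_
    · intro a b hb
      have h1 : ∀ t : Fin (2 * m), e t * ctr t (ι K a * b) =
          ι K (a t • Pi.single t (1 : K)) * b + ι K a * (e t * ctr t b) := by
        intro t
        have h2 : e t * ι K a = - (ι K a * e t) := by
          rw [e, eq_neg_iff_add_eq_zero]
          exact ι_add_mul_swap _ _
        rw [ctr_mul, mul_sub, ← mul_assoc (e t) (ι K a), h2, map_smul]
        simp [e, mul_assoc]
      rw [Num, Finset.sum_congr rfl (fun t _ => h1 t), Finset.sum_add_distrib, ← Finset.sum_mul,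
        ← map_sum, ← Finset.mul_sum]
      have h3 : ∑ t, a t • (Pi.single t (1 : K) : Fin (2 * m) → K) = a := by
        ext s
        simp [Finset.sum_apply, Pi.single_apply]
      have h4 := ih b hb
      rw [Num] at h4
      rw [h3, h4]
      push_cast
      rw [add_smul, one_smul, mul_smul_comm, add_comm]
    · intro x y hx hy
      have : Num m (x + y) = Num m x + Num m y := by
        simp [Num, mul_add, Finset.sum_add_distrib]
      rw [this, hx, hy, smul_add]

lemma p_inj {m : ℕ} (i l : Fin m) : p i = p l ↔ i = l := by simp [p, Fin.ext_iff]
lemma q_inj {m : ℕ} (i l : Fin m) : q i = q l ↔ i = l := by simp [q, Fin.ext_iff]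
lemma p_ne_q {m : ℕ} (i l : Fin m) : p i ≠ q l := by simp [p, q, Fin.ext_iff]; omega

lemma comm_one {m : ℕ} (i l : Fin m) (x : ExteriorAlgebra K (Fin (2 * m) → K)) :
    ctr (q i) (ctr (p i) (e (p l) * e (q l) * x)) =
      e (p l) * e (q l) * ctr (q i) (ctr (p i) x) +
      (if i = l then x - e (p l) * ctr (p l) x - e (q l) * ctr (q l) x else 0) := by
  rw [mul_assoc, ctr_e_mul, ctr_e_mul, if_neg (p_ne_q i l)]
  by_cases h : i = l
  · subst h
    simp only [if_true, map_sub, map_zero, zero_sub, mul_neg, sub_neg_eq_add, map_add, ctr_e_mul,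
      if_neg (p_ne_q i i).symm, mul_sub, mul_assoc]
    abel
  · simp only [p_inj, q_inj, if_neg h, map_sub, map_zero, zero_sub, mul_neg, sub_neg_eq_add,
      map_add, ctr_e_mul, if_neg (p_ne_q l i).symm, mul_sub, mul_assoc, add_zero, zero_add]

lemma comm_rel {m k : ℕ} (x : ExteriorAlgebra K (Fin (2 * m) → K))
    (hx : x ∈ ⋀[K]^k (Fin (2 * m) → K)) :
    Lam m (stdSymplecticBivector K m * x) =
      stdSymplecticBivector K m * Lam m x + ((m : K) - k) • x := by
  have hN := Num_eq k x hx
  rw [Num, sum_pq] at hN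
  rw [sub_smul, ← hN, omega_eq]
  simp only [Lam, LinearMap.sum_apply, LinearMap.comp_apply, Finset.sum_mul, map_sum, comm_one,
    Finset.sum_add_distrib, Finset.mul_sum]
  congr 1
  · rw [Finset.sum_comm]
  simp [Finset.sum_sub_distrib, Finset.sum_add_distrib, Nat.cast_smul_eq_nsmul, sub_sub]

lemma omega_mem (m : ℕ) : stdSymplecticBivector K m ∈ ⋀[K]^2 (Fin (2 * m) → K) := by
  rw [omega_eq]
  exact Submodule.sum_mem _ fun i _ => mul_mem_ext (ι_mem_ext _) (ι_mem_ext _)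

lemma omega_pow_mul_mem (m r k : ℕ) (x : ExteriorAlgebra K (Fin (2 * m) → K))
    (hx : x ∈ ⋀[K]^k (Fin (2 * m) → K)) :
    stdSymplecticBivector K m ^ r * x ∈ ⋀[K]^(2 * r + k) (Fin (2 * m) → K) := by
  induction r with
  | zero => simpa using hx
  | succ r ih =>
    rw [pow_succ', mul_assoc, show 2 * (r + 1) + k = 2 + (2 * r + k) by ring]
    exact mul_mem_ext (omega_mem m) ih

lemma comm_pow {m k : ℕ} (r : ℕ) (x : ExteriorAlgebra K (Fin (2 * m) → K))
    (hx : x ∈ ⋀[K]^k (Fin (2 * m) → K)) :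
    Lam m (stdSymplecticBivector K m ^ (r + 1) * x) =
      stdSymplecticBivector K m ^ (r + 1) * Lam m x +
        (((r : K) + 1) * ((m : K) - k - r)) • (stdSymplecticBivector K m ^ r * x) := by
  induction r with
  | zero => simpa using comm_rel x hx
  | succ r ih =>
    rw [pow_succ', mul_assoc, comm_rel _ (omega_pow_mul_mem m (r + 1) k x hx), ih, mul_add,
      mul_smul_comm, ← mul_assoc, ← mul_assoc, ← pow_succ', ← pow_succ', add_assoc, ← add_smul]
    congr 2
    push_cast
    ring

lemma Lam_mem {m k : ℕ} (x : ExteriorAlgebra K (Fin (2 * m) → K))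
    (hx : x ∈ ⋀[K]^(k + 2) (Fin (2 * m) → K)) : Lam m x ∈ ⋀[K]^k (Fin (2 * m) → K) := by
  simp only [Lam, LinearMap.sum_apply, LinearMap.comp_apply]
  exact Submodule.sum_mem _ fun i _ => ctr_mem _ _ _ (ctr_mem _ _ _ hx)

lemma Lam_low {m k : ℕ} (hk : k < 2) (x : ExteriorAlgebra K (Fin (2 * m) → K))
    (hx : x ∈ ⋀[K]^k (Fin (2 * m) → K)) : Lam m x = 0 := by
  simp only [Lam, LinearMap.sum_apply, LinearMap.comp_apply]
  refine Finset.sum_eq_zero fun i _ => ?_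
  interval_cases k
  · rw [ctr_zero _ x hx, map_zero]
  · exact ctr_zero _ _ (ctr_mem _ _ _ hx)

lemma inj [CharZero K] {m : ℕ} : ∀ (k r : ℕ), r + k ≤ m →
    ∀ x : ExteriorAlgebra K (Fin (2 * m) → K), x ∈ ⋀[K]^k (Fin (2 * m) → K) →
    stdSymplecticBivector K m ^ r * x = 0 → x = 0 := by
  intro k
  induction k using Nat.strong_induction_on with
  | _ k ih =>
  intro r
  induction r with
  | zero => intro _ x _ h; simpa using h
  | succ r ihr =>
    intro hr x hx h
    have h1 := comm_pow r x hx
    have hL : Lam m x = 0 := by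
      by_cases hk : k < 2
      · exact Lam_low hk x hx
      · obtain ⟨k, rfl⟩ : ∃ k', k = k' + 2 := ⟨k - 2, by omega⟩
        refine ih k (by omega) (r + 2) (by omega) _ (Lam_mem x hx) ?_
        rw [h, map_zero] at h1
        have h2 := congrArg (fun y => stdSymplecticBivector K m * y) h1
        simp only [mul_zero, mul_add, mul_smul_comm, ← mul_assoc, ← pow_succ'] at h2
        rw [h, smul_zero, add_zero] at h2
        exact h2.symm
    rw [h, hL, map_zero, mul_zero, zero_add] at h1
    refine ihr (by omega) x hx ?_
    refine (smul_eq_zero.mp h1.symm).resolve_left ?_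
    refine mul_ne_zero (by exact_mod_cast Nat.succ_ne_zero r) ?_
    obtain ⟨c, rfl⟩ := Nat.exists_eq_add_of_le hr
    have : ((r + 1 + k + c : ℕ) : K) - k - r = ((c + 1 : ℕ) : K) := by push_cast; ring
    rw [this]
    exact_mod_cast Nat.succ_ne_zero c

lemma finrank_ext (m k : ℕ) :
    Module.finrank K (⋀[K]^k (Fin (2 * m) → K)) = (2 * m).choose k := by
  rw [exteriorPower.finrank_eq, Module.finrank_fin_fun]

end PrimAux

open PrimAux in
/-- For a field `K` of characteristic zero, `V = K^{2m}` and `0 ≤ j ≤ m`, the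
space of primitive `j`-vectors `P^j = {α ∈ ⋀^j V : ω^{m-j+1} ∧ α = 0}` has dimension
`C(2m, j) - C(2m, j-2)` (with the convention `C(2m, -1) = C(2m, -2) = 0`). -/
theorem finrank_primitiveSubspace
    (K : Type*) [Field K] [CharZero K] (m j : ℕ) (hm : 1 ≤ m) (hj : j ≤ m) :
    (Module.finrank K (primitiveSubspace K m j) : ℤ) =
      ((2 * m).choose j : ℤ) - (if 2 ≤ j then ((2 * m).choose (j - 2) : ℤ) else 0) := by
  set A := ⋀[K]^j (Fin (2 * m) → K) with hA
  set T := LinearMap.mulLeft K ((stdSymplecticBivector K m) ^ (m - j + 1)) with hT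
  have hfin : ∀ k, Module.Finite K (⋀[K]^k (Fin (2 * m) → K)) := fun k => inferInstance
  have hAfin : Module.Finite K A := hfin j
  have h1 : Module.finrank K (A.map T) + Module.finrank K (primitiveSubspace K m j) =
      (2 * m).choose j := by
    have := LinearMap.finrank_range_add_finrank_ker (T.domRestrict A)
    rw [finrank_ext, LinearMap.range_domRestrict, LinearMap.ker_domRestrict] at this
    rw [← this]
    congr 1
    rw [primitiveSubspace, ← hT, ← hA, ← Submodule.map_comap_subtype]
    exact (Submodule.finrank_map_subtype_eq A _)
  have hle : A.map T ≤ ⋀[K]^(2 * (m - j + 1) + j) (Fin (2 * m) → K) := by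
    rintro _ ⟨x, hx, rfl⟩
    exact omega_pow_mul_mem m _ _ x hx
  have h2 := Submodule.finrank_mono hle
  rw [finrank_ext] at h2
  split_ifs with h
  · have hc : (2 * m).choose (2 * (m - j + 1) + j) = (2 * m).choose (j - 2) :=
      Nat.choose_symm_of_eq_add (by omega)
    set B := ⋀[K]^(j - 2) (Fin (2 * m) → K) with hB
    set S := LinearMap.mulLeft K ((stdSymplecticBivector K m) ^ (m - j + 2)) with hS
    have hle2 : B.map S ≤ A.map T := by
      rintro _ ⟨x, hx, rfl⟩
      refine ⟨stdSymplecticBivector K m * x, ?_, ?_⟩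
      · have := mul_mem_ext (omega_mem (K := K) m) hx
        rwa [show 2 + (j - 2) = j by omega] at this
      · simp only [hT, hS, LinearMap.mulLeft_apply]
        rw [← mul_assoc, ← pow_succ]
    have h3 := Submodule.finrank_mono hle2
    have h4 : Module.finrank K (B.map S) = (2 * m).choose (j - 2) := by
      rw [← finrank_ext (K := K), ← LinearMap.range_domRestrict]
      refine LinearMap.finrank_range_of_inj ?_
      rw [injective_iff_map_eq_zero]
      rintro ⟨x, hx⟩ h0
      have := inj (j - 2) (m - j + 2) (by omega) x hx h0
      exact Subtype.ext this
    omega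
  · rw [Nat.choose_eq_zero_of_lt (by omega)] at h2
    omega
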